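/- Let F_q be a finite field with q elements and let d be a prime number not dividing q such that q is primitive modulo d. Then the group C(d, q) of invertible d×d circulant matrices over F_q has exactly (q − 1)·(q^{d−1} − 1) elements. -/

import Mathlib

open Polynomial

/-- The shift matrix, whose polynomials are the circulant matrices. -/
def circulantShift (R : Type*) [Zero R] [One R] (d : ℕ) : Matrix (ZMod d) (ZMod d) R :=
  Matrix.of fun i j => if j - i = 1 then 1 else 0

theorem circulantShift_pow_apply (R : Type*) [Semiring R] (d : ℕ) [NeZero d] (k : ℕ)
    (i j : ZMod d) :
    (circulantShift R d ^ k) i j = if j - i = (k : ZMod d) then 1 else 0 := by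
  induction k generalizing j with
  | zero => simp [Matrix.one_apply, sub_eq_zero, eq_comm]
  | succ k ih =>
    have h (x : ZMod d) : j - x = 1 ↔ x = j - 1 := by
      rw [sub_eq_iff_eq_add, eq_sub_iff_add_eq, add_comm, eq_comm]
    have h' : j - 1 - i = (k : ZMod d) ↔ j - i = (k : ZMod d) + 1 := by
      rw [sub_right_comm, sub_eq_iff_eq_add]
    rw [pow_succ, Matrix.mul_apply]
    simp_rw [ih]
    simp [circulantShift, h, h']

theorem circulantShift_pow_self (R : Type*) [Semiring R] (d : ℕ) [NeZero d] :
    circulantShift R d ^ d = 1 := by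
  ext i j
  simp [circulantShift_pow_apply, Matrix.one_apply, sub_eq_zero, eq_comm]

theorem sum_smul_circulantShift_pow (R : Type*) [Semiring R] (d : ℕ) [NeZero d]
    (c : ZMod d → R) :
    ∑ k : ZMod d, c k • circulantShift R d ^ k.val = Matrix.of fun i j => c (j - i) := by
  ext i j
  simp [Matrix.sum_apply, circulantShift_pow_apply]

/-- Invertible circulant matrices correspond to the units of `F[X] / (X ^ d - 1)`. -/
theorem card_invertible_circulant_eq_card_units {F : Type*} [Field F] [Finite F] (d : ℕ)
    [NeZero d] :
    Nat.card {A : Matrix (ZMod d) (ZMod d) F //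
        (∃ c : ZMod d → F, A = Matrix.of fun i j => c (j - i)) ∧ IsUnit A}
      = Nat.card (AdjoinRoot (X ^ d - 1 : F[X]))ˣ := by
  have hmonic : (X ^ d - 1 : F[X]).Monic := monic_X_pow_sub_C 1 (NeZero.ne d)
  have hdeg : (X ^ d - 1 : F[X]).natDegree = d := natDegree_X_pow_sub_C
  let pb := AdjoinRoot.powerBasis' hmonic
  have : Module.Finite F (AdjoinRoot (X ^ d - 1 : F[X])) := pb.finite
  have : Finite (AdjoinRoot (X ^ d - 1 : F[X])) := Module.finite_of_finite F
  let φ : AdjoinRoot (X ^ d - 1 : F[X]) →ₐ[F] Matrix (ZMod d) (ZMod d) F :=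
    Ideal.Quotient.liftₐ _ (aeval (circulantShift F d)) fun p hp => by
      obtain ⟨r, rfl⟩ := Ideal.mem_span_singleton'.1 hp
      simp [circulantShift_pow_self]
  have hφroot : φ (AdjoinRoot.root (X ^ d - 1 : F[X])) = circulantShift F d :=
    aeval_X (circulantShift F d)
  let ψ : (ZMod d → F) →ₗ[F] AdjoinRoot (X ^ d - 1 : F[X]) :=
    Fintype.linearCombination F fun k : ZMod d => AdjoinRoot.root (X ^ d - 1 : F[X]) ^ k.val
  have hφψ (c : ZMod d → F) : φ (ψ c) = Matrix.of fun i j => c (j - i) := by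
    simp [hφroot, ψ, Fintype.linearCombination_apply, sum_smul_circulantShift_pow]
  have hcirc : Function.Injective
      fun c : ZMod d → F => (Matrix.of fun i j => c (j - i) : Matrix (ZMod d) (ZMod d) F) := by
    intro c c' h
    ext k
    simpa using congr_fun (congr_fun h 0) k
  have hψ : Function.Surjective ψ := by
    refine (LinearMap.injective_iff_surjective_of_finrank_eq_finrank ?_).1 ?_
    · rw [pb.finrank]
      simp [pb, hdeg, ZMod.card]
    · intro c c' h
      exact hcirc (by simp only [← hφψ, h])
  have hφ : Function.Injective φ := by
    intro x y h
    obtain ⟨c, rfl⟩ := hψ x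
    obtain ⟨c', rfl⟩ := hψ y
    rw [hφψ, hφψ] at h
    rw [hcirc h]
  have hunit (x) (hx : IsUnit (φ x)) : IsUnit x := by
    rw [isUnit_iff_mem_nonZeroDivisors_of_finite, mem_nonZeroDivisors_iff_right]
    intro y hy
    refine hφ ?_
    rw [map_zero, ← hx.mul_left_inj, ← map_mul, hy, map_zero, zero_mul]
  symm
  refine Nat.card_congr (Equiv.ofBijective (fun u => ⟨φ u, ?_, u.isUnit.map φ⟩) ⟨?_, ?_⟩)
  · obtain ⟨c, hc⟩ := hψ u
    exact ⟨c, by rw [← hc, hφψ]⟩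
  · intro u v h
    exact Units.ext (hφ (congr_arg Subtype.val h))
  · rintro ⟨_, ⟨c, rfl⟩, hA⟩
    rw [← hφψ] at hA
    exact ⟨(hunit _ hA).unit, Subtype.ext (hφψ c)⟩

theorem AdjoinRoot.natCard_units_of_irreducible {F : Type*} [Field F] [Finite F] {f : F[X]}
    (hf : Irreducible f) :
    Nat.card (AdjoinRoot f)ˣ = Nat.card F ^ f.natDegree - 1 := by
  have : Fact (Irreducible f) := ⟨hf⟩
  have : Module.Finite F (AdjoinRoot f) := (AdjoinRoot.powerBasis hf.ne_zero).finite
  rw [Nat.card_units, Module.natCard_eq_pow_finrank (K := F),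
    (AdjoinRoot.powerBasis hf.ne_zero).finrank, AdjoinRoot.powerBasis_dim]

theorem AdjoinRoot.natCard_units_mul {F : Type*} [Field F] {f g : F[X]} (h : IsCoprime f g) :
    Nat.card (AdjoinRoot (f * g))ˣ = Nat.card (AdjoinRoot f)ˣ * Nat.card (AdjoinRoot g)ˣ := by
  have e : AdjoinRoot (f * g) ≃+* AdjoinRoot f × AdjoinRoot g :=
    (Ideal.quotEquivOfEq (Ideal.span_singleton_mul_span_singleton f g).symm).trans
      (Ideal.quotientMulEquivQuotientProd _ _ ((Ideal.isCoprime_span_singleton_iff f g).2 h))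
  rw [Nat.card_congr ((Units.mapEquiv e.toMulEquiv).trans MulEquiv.prodUnits).toEquiv,
    Nat.card_prod]


/-- Let `F` be a finite field with `q` elements and `d` a prime not
dividing `q` such that `q` is primitive modulo `d` (the multiplicative order of `q`
modulo `d` is `d - 1`). Then the group `C(d, q)` of invertible `d × d` circulant
matrices over `F` has exactly `(q - 1) * (q^(d-1) - 1)` elements. -/
theorem card_invertible_circulant {F : Type*} [Field F] [Fintype F]
    (q d : ℕ) (hq : Fintype.card F = q) (hd : d.Prime) (hdq : ¬ d ∣ q)
    (hprim : orderOf ((q : ZMod d)) = d - 1) :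
    letI : NeZero d := ⟨hd.pos.ne'⟩
    Nat.card {A : Matrix (ZMod d) (ZMod d) F //
        (∃ c : ZMod d → F, A = Matrix.of fun i j => c (j - i)) ∧ IsUnit A}
      = (q - 1) * (q ^ (d - 1) - 1) := by
  have : NeZero d := ⟨hd.pos.ne'⟩
  obtain ⟨n, hp, hcard⟩ := FiniteField.card F (ringChar F)
  have : Fact (ringChar F).Prime := ⟨hp⟩
  have hcop : (ringChar F).Coprime d := by
    rw [Nat.coprime_primes hp hd]
    rintro rfl
    exact hdq (hq ▸ hcard ▸ dvd_pow_self _ n.ne_zero)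
  have hd0 : (d : F) ≠ 0 := by
    rw [Ne, ringChar.spec, ← hp.coprime_iff_not_dvd]
    exact hcop
  have hirr : Irreducible (cyclotomic d F) := by
    refine irreducible_of_dvd_cyclotomic_of_natDegree (p := ringChar F) (f := n)
      hcard hcop dvd_rfl ?_
    rw [natDegree_cyclotomic, Nat.totient_prime hd, ← orderOf_units, ZMod.coe_unitOfCoprime,
      ← hcard, hq, hprim]
  have hfactor : (X - C 1) * cyclotomic d F = X ^ d - 1 := by
    have : Fact d.Prime := ⟨hd⟩
    rw [mul_comm, C_1, cyclotomic_prime_mul_X_sub_one]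
  have hcoprime : IsCoprime (X - C 1) (cyclotomic d F) := by
    apply Separable.isCoprime
    rw [hfactor]
    exact X_pow_sub_one_separable_iff.2 hd0
  rw [card_invertible_circulant_eq_card_units, ← hfactor, AdjoinRoot.natCard_units_mul hcoprime,
    AdjoinRoot.natCard_units_of_irreducible (irreducible_X_sub_C 1),
    AdjoinRoot.natCard_units_of_irreducible hirr, natDegree_X_sub_C, natDegree_cyclotomic,
    Nat.totient_prime hd, Nat.card_eq_fintype_card, hq, pow_one]
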